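/- Let S := {(x₁,x₂) ∈ ℝ² : x₁ ≥ 0, x₁² − x₂³ ≥ 0} with generators g₁ = X₁ and g₂ = X₁² − X₂³. Then S is closed at ∞ (i.e. closure(S̃ᵒ) = S̃ᶜ), and the homogeneous linear polynomial g̃(X₀,X₁,X₂) := 2X₀ + 2X₁ − 3X₂ satisfies g̃(x̃) > 0 for all x̃ ∈ conv(closure(S̃ᵒ)) \ {0}; consequently conv(closure(S̃ᵒ)) is closed and pointed and Assumption A holds for S. -/

import Mathlib

open MvPolynomial Pointwise

/-- Homogenization of a polynomial in variables `X₁,…,Xₙ` (indexed by `Fin n`, shifted to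
`X₁,…,Xₙ` via `Fin.succ`) with a new homogenizing variable `X₀`. -/
noncomputable def homog {n : ℕ} (f : MvPolynomial (Fin n) ℝ) : MvPolynomial (Fin (n + 1)) ℝ :=
  ∑ α ∈ f.support,
    MvPolynomial.monomial
      (Finsupp.mapDomain Fin.succ α + Finsupp.single 0 (f.totalDegree - α.sum fun _ e => e))
      (MvPolynomial.coeff α f)

/-- The `k`-th truncated quadratic module generated by the family `g`. -/
def QMod {τ ι : Type*} [Fintype ι] (k : ℕ) (g : ι → MvPolynomial τ ℝ) :
    Set (MvPolynomial τ ℝ) :=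
  {p | ∃ s₀ : MvPolynomial τ ℝ, ∃ s : ι → MvPolynomial τ ℝ,
      IsSumSq s₀ ∧ s₀.totalDegree ≤ 2 * k ∧
      (∀ i, IsSumSq (s i) ∧ (s i * g i).totalDegree ≤ 2 * k) ∧
      p = s₀ + ∑ i, s i * g i}

/-- The homogenized generating family `G̃`. -/
noncomputable def tGens {n : ℕ} {ι : Type*} (g : ι → MvPolynomial (Fin n) ℝ) :
    ι ⊕ Fin 3 → MvPolynomial (Fin (n + 1)) ℝ :=
  Sum.elim (fun j => homog (g j))
    ![X 0, (∑ i, X i ^ 2) - 1, 1 - ∑ i, X i ^ 2]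

/-- The modified theta body `TH̃ₖ(G̃)`. -/
noncomputable def thetaB {n : ℕ} {ι : Type*} [Fintype ι] (k : ℕ)
    (g : ι → MvPolynomial (Fin n) ℝ) : Set (Fin n → ℝ) :=
  {x | ∀ l ∈ QMod k (tGens g), l.IsHomogeneous 1 → 0 ≤ eval (Fin.cons 1 x) l}

/-- The Riesz functional of a truncated moment sequence. -/
noncomputable def riesz {m : ℕ} (y : (Fin m →₀ ℕ) → ℝ) (p : MvPolynomial (Fin m) ℝ) : ℝ :=
  ∑ α ∈ p.support, MvPolynomial.coeff α p * y α

/-- The moment relaxation `Ωₖ(G̃)`. -/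
noncomputable def omegaRel {n : ℕ} {ι : Type*} [Fintype ι] (k : ℕ)
    (g : ι → MvPolynomial (Fin n) ℝ) : Set (Fin n → ℝ) :=
  {x | ∃ y : (Fin (n + 1) →₀ ℕ) → ℝ,
      riesz y (X 0) = 1 ∧
      (∀ i : Fin n, riesz y (X i.succ) = x i) ∧
      (∀ q : MvPolynomial (Fin (n + 1)) ℝ, q.totalDegree ≤ k → 0 ≤ riesz y (q ^ 2)) ∧
      (∀ q : MvPolynomial (Fin (n + 1)) ℝ, q.totalDegree ≤ k - 1 → 0 ≤ riesz y (X 0 * q ^ 2)) ∧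
      (∀ q : MvPolynomial (Fin (n + 1)) ℝ, q.totalDegree ≤ 2 * (k - 1) →
        riesz y (((∑ i, X i ^ 2) - 1) * q) = 0) ∧
      (∀ j : ι, ∀ q : MvPolynomial (Fin (n + 1)) ℝ,
        q.totalDegree ≤ k - ((g j).totalDegree + 1) / 2 → 0 ≤ riesz y (homog (g j) * q ^ 2))}

/-- The basic semialgebraic set defined by the family `g`. -/
def semiS {n : ℕ} {ι : Type*} (g : ι → MvPolynomial (Fin n) ℝ) : Set (Fin n → ℝ) :=
  {x | ∀ j, 0 ≤ eval x (g j)}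

/-- `S̃ᵒ`. -/
noncomputable def StO {n : ℕ} {ι : Type*} (g : ι → MvPolynomial (Fin n) ℝ) :
    Set (Fin (n + 1) → ℝ) :=
  {x | (∀ j, 0 ≤ eval x (homog (g j))) ∧ 0 < x 0}

/-- `S̃ᶜ`. -/
noncomputable def StC {n : ℕ} {ι : Type*} (g : ι → MvPolynomial (Fin n) ℝ) :
    Set (Fin (n + 1) → ℝ) :=
  {x | (∀ j, 0 ≤ eval x (homog (g j))) ∧ 0 ≤ x 0}

/-- `S̃ = S̃ᶜ ∩ {‖x̃‖₂ = 1}`. -/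
noncomputable def StS {n : ℕ} {ι : Type*} (g : ι → MvPolynomial (Fin n) ℝ) :
    Set (Fin (n + 1) → ℝ) :=
  {x | (∀ j, 0 ≤ eval x (homog (g j))) ∧ 0 ≤ x 0 ∧ ∑ i, x i ^ 2 = 1}

/-- Assumption A: `S` is closed at infinity, and `conv(closure(S̃ᵒ))` is closed and pointed. -/
noncomputable def AssumpA {n : ℕ} {ι : Type*} (g : ι → MvPolynomial (Fin n) ℝ) : Prop :=
  closure (StO g) = StC g ∧ IsClosed (convexHull ℝ (closure (StO g))) ∧
    convexHull ℝ (closure (StO g)) ∩ -(convexHull ℝ (closure (StO g))) = {0}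

/-- The PP-BDR property with order `k` for the set `T ⊆ ℝⁿ⁺¹` relative to the homogenized
generating family `tGens g`: outside a Lebesgue-null set of coefficient vectors, every affine
polynomial positive on `T` lies in the `k`-th truncated quadratic module of `G̃`. -/
noncomputable def ppBDR {n : ℕ} {ι : Type*} [Fintype ι] (k : ℕ)
    (g : ι → MvPolynomial (Fin n) ℝ) (T : Set (Fin (n + 1) → ℝ)) : Prop :=
  MeasureTheory.volume {c : Fin (n + 2) → ℝ |
    (∀ x ∈ T, 0 < c 0 + ∑ i : Fin (n + 1), c i.succ * x i) ∧
    (C (c 0) + ∑ i : Fin (n + 1), C (c i.succ) * X i) ∉ QMod k (tGens g)} = 0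

theorem aux_amgm (u v : ℝ) (hu : 0 ≤ u) (hv : 0 ≤ v) : 3 * (u * v ^ 2) ≤ u ^ 3 + 2 * v ^ 3 := by
  nlinarith [mul_nonneg (add_nonneg hu (add_nonneg hv hv)) (sq_nonneg (u - v))]

theorem aux_cbrt (x : ℝ) (hx : 0 ≤ x) : ∃ a : ℝ, 0 ≤ a ∧ x = a ^ 3 := by
  refine ⟨x ^ ((1 : ℝ) / 3), Real.rpow_nonneg hx _, ?_⟩
  rw [← Real.rpow_natCast, ← Real.rpow_mul hx]
  norm_num

theorem aux_hoelder (a b c d p q : ℝ) (ha : 0 ≤ a) (hb : 0 ≤ b) (hc : 0 ≤ c) (hd : 0 ≤ d)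
    (hp : 0 ≤ p) (hq : 0 ≤ q) (hP : a ^ 3 + c ^ 3 = p ^ 3) (hQ : b ^ 3 + d ^ 3 = q ^ 3) :
    a * b ^ 2 + c * d ^ 2 ≤ p * q ^ 2 := by
  have ha3 : 0 ≤ a ^ 3 := by positivity
  have hb3 : 0 ≤ b ^ 3 := by positivity
  have hc3 : 0 ≤ c ^ 3 := by positivity
  have hd3 : 0 ≤ d ^ 3 := by positivity
  rcases hp.eq_or_lt with rfl | hp
  · have h1 : a = 0 := pow_eq_zero_iff (n := 3) (by norm_num) |>.1 (by linarith)
    have h2 : c = 0 := pow_eq_zero_iff (n := 3) (by norm_num) |>.1 (by linarith)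
    simp [h1, h2]
  rcases hq.eq_or_lt with rfl | hq
  · have h1 : b = 0 := pow_eq_zero_iff (n := 3) (by norm_num) |>.1 (by linarith)
    have h2 : d = 0 := pow_eq_zero_iff (n := 3) (by norm_num) |>.1 (by linarith)
    simp [h1, h2]
  have e1 := aux_amgm (a * q) (b * p) (by positivity) (by positivity)
  have e2 := aux_amgm (c * q) (d * p) (by positivity) (by positivity)
  have e3 : (a * q) ^ 3 + 2 * (b * p) ^ 3 + ((c * q) ^ 3 + 2 * (d * p) ^ 3)
      = 3 * (p ^ 3 * q ^ 3) := by
    calc _ = (a ^ 3 + c ^ 3) * q ^ 3 + 2 * (b ^ 3 + d ^ 3) * p ^ 3 := by ring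
      _ = _ := by rw [hP, hQ]; ring
  have hk : 0 < p ^ 2 * q := by positivity
  refine le_of_mul_le_mul_left ?_ hk
  nlinarith

theorem aux_le_of_cube {x y : ℝ} (hy : 0 ≤ y) (h : x ^ 3 ≤ y ^ 3) : x ≤ y := by
  by_contra hc
  push Not at hc
  exact absurd (pow_lt_pow_left₀ hc hy (n := 3) (by norm_num)) (not_lt.2 h)

theorem aux_add (x0 x1 x2 y0 y1 y2 : ℝ) (hx0 : 0 ≤ x0) (hx1 : 0 ≤ x1) (hy0 : 0 ≤ y0)
    (hy1 : 0 ≤ y1) (hx : 0 ≤ x0 * x1 ^ 2 - x2 ^ 3) (hy : 0 ≤ y0 * y1 ^ 2 - y2 ^ 3) :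
    0 ≤ (x0 + y0) * (x1 + y1) ^ 2 - (x2 + y2) ^ 3 := by
  obtain ⟨p, hp, hP⟩ := aux_cbrt (x0 + y0) (by positivity)
  obtain ⟨q, hq, hQ⟩ := aux_cbrt (x1 + y1) (by positivity)
  rw [hP, hQ]
  obtain ⟨a, ha, rfl⟩ := aux_cbrt x0 hx0
  obtain ⟨b, hb, rfl⟩ := aux_cbrt x1 hx1
  obtain ⟨c, hc, rfl⟩ := aux_cbrt y0 hy0
  obtain ⟨d, hd, rfl⟩ := aux_cbrt y1 hy1
  have h := aux_hoelder a b c d p q ha hb hc hd hp hq hP hQ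
  have h1 : x2 ≤ a * b ^ 2 := aux_le_of_cube (by positivity) (by nlinarith)
  have h2 : y2 ≤ c * d ^ 2 := aux_le_of_cube (by positivity) (by nlinarith)
  have h3 : x2 + y2 ≤ p * q ^ 2 := by linarith
  have h4 : (x2 + y2) ^ 3 ≤ (p * q ^ 2) ^ 3 :=
    (Odd.strictMono_pow (by decide : Odd 3)).monotone h3
  nlinarith

theorem aux_pos (x0 x1 x2 : ℝ) (hx0 : 0 ≤ x0) (hx1 : 0 ≤ x1)
    (hx : 0 ≤ x0 * x1 ^ 2 - x2 ^ 3) (hle : 2 * x0 + 2 * x1 - 3 * x2 ≤ 0) :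
    x0 = 0 ∧ x1 = 0 ∧ x2 = 0 := by
  have key : 3 * x2 ≤ x0 + 2 * x1 := by
    obtain ⟨a, ha, rfl⟩ := aux_cbrt x0 hx0
    obtain ⟨b, hb, rfl⟩ := aux_cbrt x1 hx1
    have h1 : x2 ≤ a * b ^ 2 := aux_le_of_cube (by positivity) (by nlinarith)
    linarith [aux_amgm a b ha hb]
  have h0 : x0 = 0 := by linarith
  subst h0
  have h2 : x2 ≤ 0 := aux_le_of_cube le_rfl (by linarith)
  exact ⟨rfl, by linarith, by linarith⟩

/-- Example 2.15 (continued): for `S = {x : x₁ ≥ 0, x₁² - x₂³ ≥ 0}` with `g̃₁ = X₁`,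
`g̃₂ = X₀X₁² - X₂³`: `S` is closed at infinity, `g̃ = 2X₀ + 2X₁ - 3X₂` is positive on
`conv (closure S̃ᵒ) \ {0}`, and consequently `conv (closure S̃ᵒ)` is closed and pointed,
so Assumption A holds for `S`. -/
theorem stmt19 :
    letI StO : Set (Fin 3 → ℝ) :=
      {x | 0 ≤ x 1 ∧ 0 ≤ x 0 * x 1 ^ 2 - x 2 ^ 3 ∧ 0 < x 0}
    letI StC : Set (Fin 3 → ℝ) :=
      {x | 0 ≤ x 1 ∧ 0 ≤ x 0 * x 1 ^ 2 - x 2 ^ 3 ∧ 0 ≤ x 0}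
    closure StO = StC ∧
    (∀ x ∈ convexHull ℝ (closure StO), x ≠ 0 → 0 < 2 * x 0 + 2 * x 1 - 3 * x 2) ∧
    IsClosed (convexHull ℝ (closure StO)) ∧
    convexHull ℝ (closure StO) ∩ -(convexHull ℝ (closure StO)) = {0} := by
  set StO : Set (Fin 3 → ℝ) := {x | 0 ≤ x 1 ∧ 0 ≤ x 0 * x 1 ^ 2 - x 2 ^ 3 ∧ 0 < x 0}
  set StC : Set (Fin 3 → ℝ) := {x | 0 ≤ x 1 ∧ 0 ≤ x 0 * x 1 ^ 2 - x 2 ^ 3 ∧ 0 ≤ x 0}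
  have hclosed : IsClosed StC := by
    have h : StC = {x : Fin 3 → ℝ | 0 ≤ x 1} ∩
        ({x : Fin 3 → ℝ | 0 ≤ x 0 * x 1 ^ 2 - x 2 ^ 3} ∩ {x : Fin 3 → ℝ | 0 ≤ x 0}) := rfl
    rw [h]
    exact (isClosed_le (by fun_prop) (by fun_prop)).inter
      ((isClosed_le (by fun_prop) (by fun_prop)).inter (isClosed_le (by fun_prop) (by fun_prop)))
  have hcl : closure StO = StC := by
    apply Set.Subset.antisymm
    · exact closure_minimal (fun x hx => ⟨hx.1, hx.2.1, hx.2.2.le⟩) hclosed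
    · rintro x ⟨h1, h2, h0⟩
      have hc : Continuous (fun t : ℝ => x + t • (![1, 0, 0] : Fin 3 → ℝ)) := by fun_prop
      have ht : Filter.Tendsto (fun t : ℝ => x + t • (![1, 0, 0] : Fin 3 → ℝ))
          (nhdsWithin 0 (Set.Ioi 0)) (nhds x) := by
        have := (hc.tendsto 0).mono_left (nhdsWithin_le_nhds (s := Set.Ioi 0))
        simpa using this
      refine mem_closure_of_tendsto ht ?_
      filter_upwards [self_mem_nhdsWithin] with t ht
      have ht : 0 < t := ht
      refine ⟨by simpa using h1, ?_, ?_⟩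
      · simp
        nlinarith [mul_nonneg ht.le (sq_nonneg (x 1))]
      · simp
        linarith
  have hconv : Convex ℝ StC := by
    rintro x ⟨hx1, hx2, hx0⟩ y ⟨hy1, hy2, hy0⟩ a b ha hb -
    refine ⟨?_, ?_, ?_⟩
    · simp only [Pi.add_apply, Pi.smul_apply, smul_eq_mul]; positivity
    · simp only [Pi.add_apply, Pi.smul_apply, smul_eq_mul]
      apply aux_add <;> try positivity
      · have := mul_nonneg (pow_nonneg ha 3) hx2
        nlinarith
      · have := mul_nonneg (pow_nonneg hb 3) hy2
        nlinarith
    · simp only [Pi.add_apply, Pi.smul_apply, smul_eq_mul]; positivity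
  have hpos : ∀ x ∈ StC, x ≠ 0 → 0 < 2 * x 0 + 2 * x 1 - 3 * x 2 := by
    rintro x ⟨h1, h2, h0⟩ hne
    by_contra hle
    obtain ⟨e0, e1, e2⟩ := aux_pos _ _ _ h0 h1 h2 (not_lt.1 hle)
    apply hne
    ext i
    fin_cases i <;> simpa
  refine ⟨hcl, ?_⟩
  rw [hcl, hconv.convexHull_eq]
  refine ⟨hpos, hclosed, ?_⟩
  ext x
  constructor
  · rintro ⟨hx, hnx⟩
    by_contra hne
    have hne : x ≠ 0 := hne
    have e1 := hpos x hx hne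
    have e2 := hpos (-x) hnx (neg_ne_zero.2 hne)
    simp only [Pi.neg_apply] at e2
    linarith
  · intro hx
    have hx : x = 0 := hx
    subst hx
    have hz : (0 : Fin 3 → ℝ) ∈ StC := by
      refine ⟨?_, ?_, ?_⟩ <;> simp
    exact ⟨hz, by simpa using hz⟩
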